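/- arXiv:1703.05673 — 4 statements merged into one kernel-verified Lean document; each statement's English description precedes it below -/
import Mathlib

section
/- Let (α², γ, ν) be a Lévy triplet and define, for u ∈ C²(ℝ) with u, u', u'' bounded, the operators 𝒜u(x) = (1/2)α²u''(x) + γu'(x) + ∫_{ℝ∖{0}} [u(x+y) − u(x) − y u'(x) 1_{|y|≤1}] ν(dy) and 𝒜*u(x) = (1/2)α²u''(x) − γu'(x) + ∫_{ℝ∖{0}} [u(x−y) − u(x) + y u'(x) 1_{|y|≤1}] ν(dy). If f, g : ℝ → ℝ are twice continuously differentiable and f, f', f'', g, g', g'' all belong to C₀(ℝ) ∩ L¹(ℝ), then ∫_ℝ 𝒜f(x) · g(x) dx = ∫_ℝ f(x) · 𝒜*g(x) dx. -/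
open MeasureTheory Complex Filter

/-- The generator of the Lévy process with triplet `(α², γ, ν)`, on smooth functions. -/
noncomputable def levyGen (α γ : ℝ) (ν : Measure ℝ) (u : ℝ → ℝ) (x : ℝ) : ℝ :=
  (1 / 2) * α ^ 2 * deriv (deriv u) x + γ * deriv u x +
    ∫ y : ℝ, (u (x + y) - u x - (if |y| ≤ 1 then y * deriv u x else 0)) ∂ν

/-- The generator of the dual (negated) Lévy process with triplet `(α², γ, ν)`. -/
noncomputable def levyGenStar (α γ : ℝ) (ν : Measure ℝ) (u : ℝ → ℝ) (x : ℝ) : ℝ :=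
  (1 / 2) * α ^ 2 * deriv (deriv u) x - γ * deriv u x +
    ∫ y : ℝ, (u (x - y) - u x + (if |y| ≤ 1 then y * deriv u x else 0)) ∂ν

/-- `g` is continuous and vanishes at infinity. -/
def IsC0 (g : ℝ → ℝ) : Prop :=
  Continuous g ∧ Tendsto g (cocompact ℝ) (nhds 0)

/-- A continuous function vanishing at infinity is bounded. -/
lemma IsC0.exists_bound {u : ℝ → ℝ} (h : IsC0 u) : ∃ C, 0 ≤ C ∧ ∀ x, |u x| ≤ C := by
  let v : ZeroAtInftyContinuousMap ℝ ℝ := ⟨⟨u, h.1⟩, h.2⟩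
  exact ⟨‖v.toBCF‖, norm_nonneg _, fun x => v.toBCF.norm_coe_le_norm x⟩

/-- The product of an integrable function with a `C₀` function is integrable. -/
lemma IsC0.integrable_mul {u v : ℝ → ℝ} (hv : IsC0 v) (hu : Integrable u) :
    Integrable (fun x => u x * v x) := by
  obtain ⟨C, -, hC⟩ := hv.exists_bound
  exact hu.mul_bdd hv.1.aestronglyMeasurable (Eventually.of_forall hC)

/-- The compensated increment of `u` at `x`, the integrand of the jump part of the generator. -/
noncomputable def compensatedIncrement (u : ℝ → ℝ) (x y : ℝ) : ℝ :=
  u (x + y) - u x - (if |y| ≤ 1 then y * deriv u x else 0)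

/-- Second order Taylor bound. -/
lemma abs_sub_sub_mul_deriv_le {u : ℝ → ℝ} (hu : ContDiff ℝ 2 u) {K : ℝ}
    (hK : ∀ x, |deriv (deriv u) x| ≤ K) (x y : ℝ) :
    |u (x + y) - u x - y * deriv u x| ≤ K * y ^ 2 := by
  have hu1 : Differentiable ℝ u := hu.differentiable (by norm_num)
  have hu2 : Differentiable ℝ (deriv u) := by
    have : ContDiff ℝ 1 (deriv u) := hu.deriv'
    exact this.differentiable (by norm_num)
  have hK0 : 0 ≤ K := (abs_nonneg _).trans (hK 0)
  have hlip (t : ℝ) : |deriv u (x + t) - deriv u x| ≤ K * |t| := by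
    simpa using convex_univ.norm_image_sub_le_of_norm_deriv_le (f := deriv u) (C := K)
      (fun z _ => hu2 z) (fun z _ => hK z) (Set.mem_univ x) (Set.mem_univ (x + t))
  have hd (t : ℝ) : HasDerivAt (fun t => u (x + t) - u x - t * deriv u x)
      (deriv u (x + t) - deriv u x) t := by
    have h1 : HasDerivAt (fun t => u (x + t)) (deriv u (x + t)) t :=
      (hu1 (x + t)).hasDerivAt.comp_const_add x t
    have h2 := (h1.sub_const (u x)).sub ((hasDerivAt_id t).mul_const (deriv u x))
    rw [one_mul] at h2
    exact h2
  have h := (convex_Icc (-|y|) |y|).norm_image_sub_le_of_norm_hasDerivWithin_le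
    (C := K * |y|) (fun t _ => (hd t).hasDerivWithinAt)
    (fun t ht => (hlip t).trans (mul_le_mul_of_nonneg_left (abs_le.2 ht) hK0))
    (x := 0) (y := y) ⟨by simp, abs_nonneg y⟩ (abs_le.1 le_rfl)
  simp only [add_zero, sub_self, zero_mul, sub_zero, Real.norm_eq_abs] at h
  rwa [mul_assoc, abs_mul_abs_self, ← sq] at h

lemma exists_abs_compensatedIncrement_le {u : ℝ → ℝ} (hu : ContDiff ℝ 2 u) (h0 : IsC0 u)
    (h2 : IsC0 (deriv (deriv u))) :
    ∃ C, ∀ x y, |compensatedIncrement u x y| ≤ C * min (y ^ 2) 1 := by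
  obtain ⟨A, hA0, hA⟩ := h0.exists_bound
  obtain ⟨K, hK0, hK⟩ := h2.exists_bound
  refine ⟨K + 2 * A, fun x y => ?_⟩
  unfold compensatedIncrement
  split_ifs with hy
  · have hy2 : y ^ 2 ≤ 1 := (sq_le_one_iff_abs_le_one y).2 hy
    rw [min_eq_left hy2]
    have := abs_sub_sub_mul_deriv_le hu hK x y
    nlinarith [sq_nonneg y]
  · have hy2 : 1 ≤ y ^ 2 := (one_le_sq_iff_one_le_abs y).2 (not_le.1 hy).le
    rw [min_eq_right hy2, sub_zero]
    have := abs_sub (u (x + y)) (u x)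
    linarith [hA x, hA (x + y)]

lemma measurable_compensatedIncrement {u : ℝ → ℝ} (h0 : Continuous u) :
    Measurable (fun p : ℝ × ℝ => compensatedIncrement u p.1 p.2) := by
  unfold compensatedIncrement
  refine (by fun_prop : Measurable fun p : ℝ × ℝ => u (p.1 + p.2) - u p.1).sub
    (Measurable.ite ?_ (by fun_prop) measurable_const)
  exact measurableSet_le (by fun_prop) measurable_const

/-- A Lévy measure is σ-finite. -/
lemma sigmaFinite_of_integrable_min_sq {ν : Measure ℝ} (hν0 : ν {0} = 0)
    (hν : Integrable (fun y : ℝ => min (y ^ 2) 1) ν) : SigmaFinite ν := by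
  refine ⟨⟨⟨fun n : ℕ => {0} ∪ {y | 1 / ((n : ℝ) + 1) ≤ ‖min (y ^ 2) 1‖}, fun _ => trivial,
    fun n => ?_, Set.eq_univ_of_forall fun y => ?_⟩⟩⟩
  · refine (measure_union_le _ _).trans_lt (ENNReal.add_lt_top.2 ⟨by simp [hν0], ?_⟩)
    exact hν.measure_norm_ge_lt_top (by positivity)
  · rcases eq_or_ne y 0 with rfl | hy
    · exact Set.mem_iUnion.2 ⟨0, Or.inl rfl⟩
    · have hpos : 0 < min (y ^ 2) 1 := lt_min (by positivity) one_pos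
      obtain ⟨n, hn⟩ := exists_nat_one_div_lt hpos
      exact Set.mem_iUnion.2 ⟨n, Or.inr (hn.le.trans (le_abs_self _))⟩

/-- Joint integrability of a weighted compensated increment. -/
lemma integrable_mul_compensatedIncrement {ν : Measure ℝ} [SigmaFinite ν]
    (hν : Integrable (fun y : ℝ => min (y ^ 2) 1) ν) {u v : ℝ → ℝ} (hu : ContDiff ℝ 2 u)
    (h0 : IsC0 u) (h2 : IsC0 (deriv (deriv u))) (hv : Integrable v)
    {s : ℝ → ℝ} (hs : Measurable s) (hsq : ∀ y, s y ^ 2 = y ^ 2) :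
    Integrable (fun p : ℝ × ℝ => v p.1 * compensatedIncrement u p.1 (s p.2))
      (volume.prod ν) := by
  obtain ⟨C, hC⟩ := exists_abs_compensatedIncrement_le hu h0 h2
  refine ((hv.mul_prod hν).const_mul C).mono ?_ (Eventually.of_forall fun p => ?_)
  · exact hv.aestronglyMeasurable.comp_fst.mul
      ((measurable_compensatedIncrement h0.1).comp
        (measurable_fst.prodMk (hs.comp measurable_snd))).aestronglyMeasurable
  · have h := (hC p.1 (s p.2)).trans (le_abs_self _)
    rw [hsq, abs_mul] at h
    simp only [Real.norm_eq_abs, abs_mul]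
    nlinarith [mul_le_mul_of_nonneg_left h (abs_nonneg (v p.1))]

/-- Integration by parts on the line for `C₀ ∩ L¹` functions. -/
lemma integral_deriv_mul_eq_neg {u v : ℝ → ℝ} (hu : Differentiable ℝ u)
    (hv : Differentiable ℝ v) (hui : Integrable u) (hui1 : Integrable (deriv u))
    (hv0 : IsC0 v) (hv1 : IsC0 (deriv v)) :
    ∫ x, deriv u x * v x = -∫ x, u x * deriv v x := by
  have := integral_mul_deriv_eq_deriv_mul_of_integrable
    (fun x _ => (hu x).hasDerivAt) (fun x _ => (hv x).hasDerivAt)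
    (hv1.integrable_mul hui) (hv0.integrable_mul hui1) (hv0.integrable_mul hui)
  rw [this, neg_neg]

/-- Duality of the compensated increments with jump sizes `y` and `-y`. -/
lemma integral_mul_compensatedIncrement {f g : ℝ → ℝ} (hf : Differentiable ℝ f)
    (hg : Differentiable ℝ g) (hfi : Integrable f) (hfi1 : Integrable (deriv f))
    (hg0 : IsC0 g) (hg1 : IsC0 (deriv g)) (y : ℝ) :
    ∫ x, g x * compensatedIncrement f x y = ∫ x, f x * compensatedIncrement g x (-y) := by
  obtain ⟨c, hc, hc'⟩ : ∃ c : ℝ, (∀ x, (if |y| ≤ 1 then y * deriv f x else 0) = c * deriv f x) ∧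
      ∀ x, (if |-y| ≤ 1 then -y * deriv g x else 0) = -c * deriv g x := by
    by_cases hy : |y| ≤ 1
    · exact ⟨y, by simp [hy], by simp [hy]⟩
    · exact ⟨0, by simp [hy], by simp [hy]⟩
  have hl : ∀ x, g x * compensatedIncrement f x y =
      f (x + y) * g x - f x * g x - c * (deriv f x * g x) := fun x => by
    rw [compensatedIncrement, hc]; ring
  have hr : ∀ x, f x * compensatedIncrement g x (-y) =
      f x * g (x + -y) - f x * g x + c * (f x * deriv g x) := fun x => by
    rw [compensatedIncrement, hc']; ring
  have hshift : ∫ x, f (x + y) * g x = ∫ x, f x * g (x + -y) := by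
    rw [← integral_add_right_eq_self (fun x => f x * g (x + -y)) y]
    simp
  have i1 : Integrable fun x => f (x + y) * g x := hg0.integrable_mul (hfi.comp_add_right y)
  have i2 : Integrable fun x => f x * g (x + -y) := by
    simpa using i1.comp_add_right (-y)
  have i3 := hg0.integrable_mul hfi
  have i13 : Integrable fun x => f (x + y) * g x - f x * g x := i1.sub i3
  have i23 : Integrable fun x => f x * g (x + -y) - f x * g x := i2.sub i3
  simp only [hl, hr]
  rw [integral_sub i13 ((hg0.integrable_mul hfi1).const_mul c), integral_sub i1 i3,
    integral_add i23 ((hg1.integrable_mul hfi).const_mul c), integral_sub i2 i3,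
    integral_const_mul, integral_const_mul, hshift,
    integral_deriv_mul_eq_neg hf hg hfi hfi1 hg0 hg1]
  ring

theorem stmt6 (α γ : ℝ) (ν : Measure ℝ)
    (hν0 : ν {0} = 0) (hν : Integrable (fun y : ℝ => min (y ^ 2) 1) ν)
    (f g : ℝ → ℝ) (hf : ContDiff ℝ 2 f) (hg : ContDiff ℝ 2 g)
    (hf0 : IsC0 f) (hf1 : IsC0 (deriv f)) (hf2 : IsC0 (deriv (deriv f)))
    (hfi : Integrable f) (hfi1 : Integrable (deriv f)) (hfi2 : Integrable (deriv (deriv f)))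
    (hg0 : IsC0 g) (hg1 : IsC0 (deriv g)) (hg2 : IsC0 (deriv (deriv g)))
    (hgi : Integrable g) (hgi1 : Integrable (deriv g)) (hgi2 : Integrable (deriv (deriv g))) :
    ∫ x : ℝ, levyGen α γ ν f x * g x = ∫ x : ℝ, f x * levyGenStar α γ ν g x := by
  have := sigmaFinite_of_integrable_min_sq hν0 hν
  have df : Differentiable ℝ f := hf.differentiable (by norm_num)
  have dg : Differentiable ℝ g := hg.differentiable (by norm_num)
  have df1 : Differentiable ℝ (deriv f) :=
    (show ContDiff ℝ 1 (deriv f) from hf.deriv').differentiable (by norm_num)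
  have dg1 : Differentiable ℝ (deriv g) :=
    (show ContDiff ℝ 1 (deriv g) from hg.deriv').differentiable (by norm_num)
  have jf := integrable_mul_compensatedIncrement hν hf hf0 hf2 hgi measurable_id
    (fun _ => rfl)
  have jg := integrable_mul_compensatedIncrement hν hg hg0 hg2 hfi measurable_neg neg_sq
  simp only [id] at jf
  have jump : ∫ x, ∫ y, g x * compensatedIncrement f x y ∂ν =
      ∫ x, ∫ y, f x * compensatedIncrement g x (-y) ∂ν := by
    refine (integral_integral_swap jf).trans (Eq.trans ?_ (integral_integral_swap jg).symm)
    exact integral_congr_ae (Eventually.of_forall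
      (integral_mul_compensatedIncrement df dg hfi hfi1 hg0 hg1))
  have hl : ∀ x, levyGen α γ ν f x * g x = (1 / 2) * α ^ 2 * (deriv (deriv f) x * g x) +
      γ * (deriv f x * g x) + ∫ y, g x * compensatedIncrement f x y ∂ν := fun x => by
    rw [integral_const_mul]
    simp only [levyGen, compensatedIncrement]
    ring
  have hr : ∀ x, f x * levyGenStar α γ ν g x = (1 / 2) * α ^ 2 * (f x * deriv (deriv g) x) -
      γ * (f x * deriv g x) + ∫ y, f x * compensatedIncrement g x (-y) ∂ν := fun x => by
    have : ∀ y, compensatedIncrement g x (-y) =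
        g (x - y) - g x + (if |y| ≤ 1 then y * deriv g x else 0) := fun y => by
      rw [compensatedIncrement, abs_neg, ← sub_eq_add_neg]
      split_ifs <;> ring
    rw [integral_const_mul]
    simp only [levyGenStar, this]
    ring
  have a1 := (hg0.integrable_mul hfi2).const_mul ((1 / 2) * α ^ 2)
  have a2 := (hg0.integrable_mul hfi1).const_mul γ
  have b1 := (hg2.integrable_mul hfi).const_mul ((1 / 2) * α ^ 2)
  have b2 := (hg1.integrable_mul hfi).const_mul γ
  have a12 : Integrable fun x => (1 / 2) * α ^ 2 * (deriv (deriv f) x * g x) +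
      γ * (deriv f x * g x) := a1.add a2
  have b12 : Integrable fun x => (1 / 2) * α ^ 2 * (f x * deriv (deriv g) x) -
      γ * (f x * deriv g x) := b1.sub b2
  have a3 : Integrable fun x => ∫ y, g x * compensatedIncrement f x y ∂ν :=
    jf.integral_prod_left
  have b3 : Integrable fun x => ∫ y, f x * compensatedIncrement g x (-y) ∂ν :=
    jg.integral_prod_left
  simp only [hl, hr]
  rw [integral_add a12 a3, integral_add a1 a2,
    integral_add b12 b3, integral_sub b1 b2, jump]
  simp only [integral_const_mul]
  rw [integral_deriv_mul_eq_neg df1 dg hfi1 hfi2 hg0 hg1,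
    integral_deriv_mul_eq_neg df dg1 hfi hfi1 hg1 hg2,
    integral_deriv_mul_eq_neg df dg hfi hfi1 hg0 hg1]
  ring
end

section
/- Let (Ω, 𝓕, P) be a probability space equipped with a filtration (𝓕_t)_{t≥0}, and let L : [0,∞) × Ω → ℝ be progressively measurable with respect to (𝓕_t). Fix u ∈ ℝ and c ∈ ℂ, and suppose that for all 0 ≤ s ≤ t the increment L_t − L_s is independent of the σ-algebra 𝓕_s and E[e^{iu(L_t − L_s)}] = e^{(t−s)c}. Then the complex-valued process M_t := e^{iuL_t} − e^{iuL_0} − c · ∫_0^t e^{iuL_r} dr, t ≥ 0, is an (𝓕_t)-martingale. -/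
open MeasureTheory Complex Filter

section Progressive

variable {Ω E : Type*} {m0 : MeasurableSpace Ω} {𝓕 : Filtration ℝ m0} {X : ℝ → Ω → E}

/-- A progressive process stopped at the deterministic time `t` is jointly measurable with respect
to the `σ`-algebra at time `t`. -/
theorem stronglyMeasurable_min_of_isStronglyProgressive [TopologicalSpace E]
    (hX : IsStronglyProgressive 𝓕 X) (t : ℝ) :
    StronglyMeasurable[Real.measurableSpace.prod (𝓕 t)]
      (fun p : ℝ × Ω => X (min p.1 t) p.2) := by
  let _ : MeasurableSpace Ω := 𝓕 t
  have hmin : Measurable fun p : ℝ × Ω =>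
      ((⟨min p.1 t, Set.mem_Iic.2 (min_le_right _ _)⟩ : Set.Iic t), p.2) :=
    ((measurable_fst.min measurable_const).subtype_mk).prodMk measurable_snd
  exact (hX t).comp_measurable hmin

variable [NormedAddCommGroup E]

/-- The restriction of a bounded progressive process to `(s, t] × Ω` is integrable. -/
theorem integrable_prod_of_isStronglyProgressive (P : Measure Ω) [IsFiniteMeasure P]
    (hX : IsStronglyProgressive 𝓕 X) {C : ℝ} (hC : ∀ r ω, ‖X r ω‖ ≤ C) (s t : ℝ) :
    Integrable (Function.uncurry X) ((volume.restrict (Set.Ioc s t)).prod P) := by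
  have hmin : Integrable (fun p : ℝ × Ω => X (min p.1 t) p.2)
      ((volume.restrict (Set.Ioc s t)).prod P) := by
    refine Integrable.of_bound ?_ C (ae_of_all _ fun p => hC _ _)
    exact ((stronglyMeasurable_min_of_isStronglyProgressive hX t).mono
      (sup_le_sup le_rfl (MeasurableSpace.comap_mono (𝓕.le t)))).aestronglyMeasurable
  refine hmin.congr ?_
  have hle : ∀ᵐ r ∂(volume.restrict (Set.Ioc s t)), r ≤ t :=
    (ae_restrict_mem measurableSet_Ioc).mono fun r hr => hr.2
  filter_upwards [Measure.quasiMeasurePreserving_fst.ae hle] with p hp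
  simp [Function.uncurry, min_eq_left hp]

/-- The paths of a bounded progressive process are interval integrable. -/
theorem intervalIntegrable_of_isStronglyProgressive
    (hX : IsStronglyProgressive 𝓕 X) {C : ℝ} (hC : ∀ r ω, ‖X r ω‖ ≤ C) (ω : Ω)
    {s t : ℝ} (hst : s ≤ t) :
    IntervalIntegrable (fun r => X r ω) volume s t := by
  rw [intervalIntegrable_iff_integrableOn_Ioc_of_le hst]
  have hmin : IntegrableOn (fun r => X (min r t) ω) (Set.Ioc s t) := by
    let _ : MeasurableSpace Ω := 𝓕 t
    exact Integrable.of_bound ((stronglyMeasurable_min_of_isStronglyProgressive hX t).comp_measurable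
      measurable_prodMk_right).aestronglyMeasurable C (ae_of_all _ fun r => hC _ _)
  exact hmin.congr_fun (fun r hr => by simp only [min_eq_left hr.2]) measurableSet_Ioc

variable [NormedSpace ℝ E]

/-- The time integral up to `t` of a progressive process is measurable at time `t`. -/
theorem stronglyMeasurable_intervalIntegral_of_isStronglyProgressive
    (hX : IsStronglyProgressive 𝓕 X) {s t : ℝ} (hst : s ≤ t) :
    StronglyMeasurable[𝓕 t] (fun ω => ∫ r in s..t, X r ω) := by
  have hmin : ∀ ω, ∫ r in s..t, X r ω = ∫ r in Set.Ioc s t, X (min r t) ω := fun ω => by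
    rw [intervalIntegral.integral_of_le hst]
    exact setIntegral_congr_fun measurableSet_Ioc fun r hr => by
      simp only [min_eq_left hr.2]
  simp_rw [hmin]
  let _ : MeasurableSpace Ω := 𝓕 t
  exact (stronglyMeasurable_min_of_isStronglyProgressive hX t).integral_prod_left'

end Progressive

/-- If `Y` is measurable with respect to a `σ`-algebra independent of the real random variable `Z`,
then `Y` and any measurable function of `Z` factorize under set integrals. -/
theorem setIntegral_mul_comp_of_indep {Ω : Type*} {m m0 : MeasurableSpace Ω} {P : Measure Ω}
    (hm : m ≤ m0) {Z : Ω → ℝ} (hZ : Measurable Z)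
    (hind : ProbabilityTheory.Indep (MeasurableSpace.comap Z Real.measurableSpace) m P)
    {φ : ℝ → ℂ} (hφ : Measurable φ) {Y : Ω → ℂ} (hY : Measurable[m] Y)
    {A : Set Ω} (hA : MeasurableSet[m] A) :
    ∫ ω in A, φ (Z ω) * Y ω ∂P = (∫ ω, φ (Z ω) ∂P) * ∫ ω in A, Y ω ∂P := by
  have hYA : Measurable[m] (A.indicator Y) := hY.indicator hA
  have hfun : ProbabilityTheory.IndepFun (fun ω => φ (Z ω)) (A.indicator Y) P := by
    rw [ProbabilityTheory.IndepFun_iff_Indep]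
    refine ProbabilityTheory.indep_of_indep_of_le_left
      (ProbabilityTheory.indep_of_indep_of_le_right hind hYA.comap_le) ?_
    exact (hφ.comp (comap_measurable Z)).comap_le
  rw [← integral_indicator (hm _ hA), ← integral_indicator (hm _ hA),
    ← hfun.integral_fun_mul_eq_mul_integral (hφ.comp hZ).aestronglyMeasurable
      (hYA.mono hm le_rfl).aestronglyMeasurable]
  exact integral_congr_ae (ae_of_all _ fun ω => Set.indicator_mul_right A (fun ω => φ (Z ω)) Y)

theorem mul_intervalIntegral_exp_sub_mul (c : ℂ) (s t : ℝ) :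
    c * ∫ r in s..t, Complex.exp (((r - s : ℝ) : ℂ) * c) =
      Complex.exp (((t - s : ℝ) : ℂ) * c) - 1 := by
  have hderiv : ∀ r : ℝ, HasDerivAt (fun r : ℝ => Complex.exp (((r - s : ℝ) : ℂ) * c))
      (c * Complex.exp (((r - s : ℝ) : ℂ) * c)) r := fun r => by
    have h := ((((hasDerivAt_id r).sub_const s).ofReal_comp).mul_const c).cexp
    simpa [mul_comm] using h
  rw [← intervalIntegral.integral_const_mul,
    intervalIntegral.integral_eq_sub_of_hasDerivAt (fun r _ => hderiv r)
      (Continuous.intervalIntegrable (by fun_prop) _ _)]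
  simp

theorem stmt9 {Ω : Type*} {m0 : MeasurableSpace Ω} (P : Measure Ω) [IsProbabilityMeasure P]
    (𝓕 : Filtration ℝ m0) (L : ℝ → Ω → ℝ) (hprog : ProgMeasurable 𝓕 L)
    (u : ℝ) (c : ℂ)
    (hindep : ∀ s t : ℝ, 0 ≤ s → s ≤ t →
      ProbabilityTheory.Indep
        (MeasurableSpace.comap (fun ω => L t ω - L s ω) Real.measurableSpace) (𝓕 s) P)
    (hchar : ∀ s t : ℝ, 0 ≤ s → s ≤ t →
      ∫ ω, Complex.exp (Complex.I * u * (L t ω - L s ω)) ∂P = Complex.exp (((t - s : ℝ) : ℂ) * c))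
    (M : ℝ → Ω → ℂ)
    (hM : ∀ t : ℝ, ∀ ω : Ω, M t ω =
      Complex.exp (Complex.I * u * L t ω) - Complex.exp (Complex.I * u * L 0 ω) -
        c * ∫ r in (0 : ℝ)..t, Complex.exp (Complex.I * u * L r ω)) :
    (∀ t : ℝ, 0 ≤ t → StronglyMeasurable[𝓕 t] (M t)) ∧
      (∀ t : ℝ, 0 ≤ t → Integrable (M t) P) ∧
      ∀ s t : ℝ, 0 ≤ s → s ≤ t → P[M t|𝓕 s] =ᵐ[P] M s := by
  set e : ℝ → Ω → ℂ := fun r ω => Complex.exp (Complex.I * u * L r ω) with he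
  have hφ : Continuous fun x : ℝ => Complex.exp (Complex.I * u * x) := by fun_prop
  have hprog_e : IsStronglyProgressive 𝓕 e := fun t =>
    hφ.comp_stronglyMeasurable (hprog t)
  have hnorm : ∀ r ω, ‖e r ω‖ ≤ 1 := fun r ω => by
    have h := Complex.norm_exp_I_mul_ofReal (u * L r ω)
    push_cast at h
    rw [← mul_assoc] at h
    exact h.le
  have hL : ∀ t, Measurable[𝓕 t] (L t) := fun t =>
    (IsStronglyProgressive.stronglyAdapted hprog t).measurable
  have he_meas : ∀ t, StronglyMeasurable[𝓕 t] (e t) := hprog_e.stronglyAdapted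
  have he_int : ∀ t, Integrable (e t) P := fun t =>
    Integrable.of_bound ((he_meas t).mono (𝓕.le t)).aestronglyMeasurable 1
      (ae_of_all _ (hnorm t))
  have hI_meas : ∀ s t, s ≤ t → StronglyMeasurable[𝓕 t] (fun ω => ∫ r in s..t, e r ω) :=
    fun s t hst => stronglyMeasurable_intervalIntegral_of_isStronglyProgressive hprog_e hst
  have hI_int : ∀ s t, s ≤ t → Integrable (fun ω => ∫ r in s..t, e r ω) P := fun s t hst => by
    simp_rw [intervalIntegral.integral_of_le hst]
    exact (integrable_prod_of_isStronglyProgressive P hprog_e hnorm s t).integral_prod_right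
  have hM' : ∀ t, M t = fun ω => e t ω - e 0 ω - c * ∫ r in (0 : ℝ)..t, e r ω :=
    fun t => funext (hM t)
  have hM_meas : ∀ t : ℝ, 0 ≤ t → StronglyMeasurable[𝓕 t] (M t) := fun t ht => by
    rw [hM' t]
    exact ((he_meas t).sub ((he_meas 0).mono (𝓕.mono ht))).sub ((hI_meas 0 t ht).const_mul c)
  have hM_int : ∀ t : ℝ, 0 ≤ t → Integrable (M t) P := fun t ht => by
    rw [hM' t]
    exact ((he_int t).sub (he_int 0)).sub ((hI_int 0 t ht).const_mul c)
  refine ⟨hM_meas, hM_int, fun s t hs hst => ?_⟩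
  have ht : 0 ≤ t := hs.trans hst
  refine (ae_eq_condExp_of_forall_setIntegral_eq (𝓕.le s) (hM_int t ht)
    (fun A _ _ => (hM_int s hs).integrableOn) (fun A hA _ => ?_)
    (hM_meas s hs).aestronglyMeasurable).symm
  have hset : ∀ r, s ≤ r → ∫ ω in A, e r ω ∂P =
      Complex.exp (((r - s : ℝ) : ℂ) * c) * ∫ ω in A, e s ω ∂P := fun r hr => by
    rw [← hchar s r hs hr]
    have h := setIntegral_mul_comp_of_indep (𝓕.le s)
      (((hL r).mono (𝓕.le r) le_rfl).sub ((hL s).mono (𝓕.le s) le_rfl))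
      (hindep s r hs hr) hφ.measurable (he_meas s).measurable hA
    simp only [Pi.sub_apply, Complex.ofReal_sub] at h
    rw [← h]
    refine integral_congr_ae (ae_of_all _ fun ω => ?_)
    simp only [he, ← Complex.exp_add]
    ring_nf
  have hswap : c * ∫ ω in A, (∫ r in s..t, e r ω) ∂P =
      (∫ ω in A, e t ω ∂P) - ∫ ω in A, e s ω ∂P := by
    have hfubini : ∫ ω in A, (∫ r in s..t, e r ω) ∂P =
        ∫ r in s..t, (∫ ω in A, e r ω ∂P) := by
      simp_rw [intervalIntegral.integral_of_le hst]
      exact (integral_integral_swap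
        (integrable_prod_of_isStronglyProgressive (P.restrict A) hprog_e hnorm s t)).symm
    have hcongr : ∫ r in s..t, (∫ ω in A, e r ω ∂P) =
        ∫ r in s..t, Complex.exp (((r - s : ℝ) : ℂ) * c) * ∫ ω in A, e s ω ∂P :=
      intervalIntegral.integral_congr fun r hr => hset r (Set.uIcc_of_le hst ▸ hr).1
    rw [hfubini, hcongr, intervalIntegral.integral_mul_const, ← mul_assoc,
      mul_intervalIntegral_exp_sub_mul, hset t hst]
    ring
  have hdiff : ∀ ω, M t ω = M s ω + ((e t ω - e s ω) - c * ∫ r in s..t, e r ω) := fun ω => by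
    rw [hM' t, hM' s]
    simp only
    rw [← intervalIntegral.integral_add_adjacent_intervals
      (intervalIntegrable_of_isStronglyProgressive hprog_e hnorm ω hs)
      (intervalIntegrable_of_isStronglyProgressive hprog_e hnorm ω hst)]
    ring
  simp_rw [hdiff]
  have hincr : Integrable (fun ω => e t ω - e s ω) P := (he_int t).sub (he_int s)
  have hcomp : Integrable (fun ω => c * ∫ r in s..t, e r ω) P := (hI_int s t hst).const_mul c
  have hdiff_int : Integrable (fun ω => (e t ω - e s ω) - c * ∫ r in s..t, e r ω) P :=
    hincr.sub hcomp
  rw [integral_add (hM_int s hs).integrableOn hdiff_int.integrableOn,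
    integral_sub hincr.integrableOn hcomp.integrableOn,
    integral_sub (he_int t).integrableOn (he_int s).integrableOn,
    integral_const_mul, hswap]
  ring
end

section
/- Let η be the characteristic exponent associated with a Lévy triplet (α², γ, ν) with α ≠ 0 or ν ≠ 0. Then there exist constants C > 0 and ε > 0 such that −Re(η(ξ)) ≥ C·ξ² for all ξ ∈ ℝ with |ξ| ≤ ε. -/
open MeasureTheory Complex Filter

/-- The characteristic exponent associated with a Lévy triplet `(α², γ, ν)`. -/
noncomputable def levyExp (α γ : ℝ) (ν : Measure ℝ) (u : ℝ) : ℂ :=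
  -(1 / 2 : ℂ) * (α : ℂ) ^ 2 * (u : ℂ) ^ 2 + Complex.I * (u : ℂ) * (γ : ℂ) +
    ∫ y : ℝ, (Complex.exp (Complex.I * u * y) - 1 -
      (if |y| ≤ 1 then Complex.I * u * y else 0)) ∂ν

/-- A quadratic bound on the first-order Taylor remainder of `exp` on the imaginary axis. -/
lemma norm_exp_I_mul_sub_one_sub_le (x : ℝ) :
    ‖Complex.exp (I * x) - 1 - I * x‖ ≤ 3 * x ^ 2 := by
  have hx : ‖I * (x : ℂ)‖ = |x| := by simp
  rcases le_or_gt |x| 1 with h | h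
  · have := Complex.norm_exp_sub_one_sub_id_le (hx.trans_le h)
    rw [hx, sq_abs] at this
    nlinarith [sq_nonneg x]
  · have h1 : ‖Complex.exp (I * x)‖ = 1 := Complex.norm_exp_I_mul_ofReal x
    have h2 := norm_sub_le (Complex.exp (I * x) - 1) (I * x)
    have h3 := norm_sub_le (Complex.exp (I * x)) 1
    rw [norm_one] at h3
    nlinarith [sq_abs x]

/-- The Lévy–Khintchine integrand is integrable against a Lévy measure. -/
lemma integrable_levyExp_integrand {ν : Measure ℝ}
    (hν : Integrable (fun y : ℝ => min (y ^ 2) 1) ν) (u : ℝ) :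
    Integrable (fun y : ℝ => Complex.exp (I * u * y) - 1 -
      (if |y| ≤ 1 then I * u * y else 0)) ν := by
  refine (hν.const_mul (3 * u ^ 2 + 2)).mono' ?_ (ae_of_all _ fun y => ?_)
  · refine Measurable.aestronglyMeasurable (Measurable.sub (by fun_prop) ?_)
    exact Measurable.ite (measurableSet_le (by fun_prop) (by fun_prop)) (by fun_prop) (by fun_prop)
  · have hmul : I * (u : ℂ) * (y : ℂ) = I * ((u * y : ℝ) : ℂ) := by push_cast; ring
    rw [hmul]
    split_ifs with h
    · have hy : y ^ 2 ≤ 1 := (sq_le_one_iff_abs_le_one y).2 h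
      rw [min_eq_left hy]
      nlinarith [norm_exp_I_mul_sub_one_sub_le (u * y), sq_nonneg y]
    · have hy : 1 ≤ y ^ 2 := (one_le_sq_iff_one_le_abs y).2 (not_le.1 h).le
      have h3 := norm_sub_le (Complex.exp (I * ((u * y : ℝ) : ℂ))) 1
      rw [Complex.norm_exp_I_mul_ofReal, norm_one] at h3
      rw [min_eq_right hy, sub_zero]
      nlinarith [sq_nonneg u]

lemma re_levyExp_integrand (u y : ℝ) :
    (Complex.exp (I * u * y) - 1 - (if |y| ≤ 1 then I * u * y else 0)).re =
      Real.cos (u * y) - 1 := by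
  have hmul : I * (u : ℂ) * (y : ℂ) = ((u * y : ℝ) : ℂ) * I := by push_cast; ring
  rw [hmul, Complex.sub_re, Complex.sub_re, Complex.exp_ofReal_mul_I_re]
  split_ifs <;> simp

lemma integrable_one_sub_cos {ν : Measure ℝ}
    (hν : Integrable (fun y : ℝ => min (y ^ 2) 1) ν) (u : ℝ) :
    Integrable (fun y : ℝ => 1 - Real.cos (u * y)) ν := by
  refine (integrable_levyExp_integrand hν u).re.neg.congr (ae_of_all _ fun y => ?_)
  have := re_levyExp_integrand u y
  simp only [Pi.neg_apply, RCLike.re_eq_complex_re, this]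
  ring

lemma neg_re_levyExp {ν : Measure ℝ}
    (hν : Integrable (fun y : ℝ => min (y ^ 2) 1) ν) (α γ u : ℝ) :
    -(levyExp α γ ν u).re = α ^ 2 / 2 * u ^ 2 + ∫ y, (1 - Real.cos (u * y)) ∂ν := by
  have hint : (∫ y : ℝ, (Complex.exp (I * u * y) - 1 -
      (if |y| ≤ 1 then I * u * y else 0)) ∂ν).re = -∫ y, (1 - Real.cos (u * y)) ∂ν := by
    rw [← integral_neg, ← RCLike.re_eq_complex_re,
      ← integral_re (integrable_levyExp_integrand hν u)]
    refine integral_congr_ae (ae_of_all _ fun y => ?_)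
    have := re_levyExp_integrand u y
    simp only [RCLike.re_eq_complex_re, this]
    ring
  have hgauss : (-(1 / 2 : ℂ) * (α : ℂ) ^ 2 * (u : ℂ) ^ 2 + I * (u : ℂ) * (γ : ℂ)).re =
      -(α ^ 2 / 2 * u ^ 2) := by
    have : -(1 / 2 : ℂ) * (α : ℂ) ^ 2 * (u : ℂ) ^ 2 + I * (u : ℂ) * (γ : ℂ) =
        ((-(α ^ 2 / 2 * u ^ 2) : ℝ) : ℂ) + ((u * γ : ℝ) : ℂ) * I := by push_cast; ring
    rw [this, Complex.add_re, Complex.ofReal_re, Complex.re_ofReal_mul, I_re]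
    ring
  rw [levyExp, Complex.add_re, hgauss, hint]
  ring

/-- A nonzero measure without an atom at the origin charges the nonzero points of some
bounded symmetric interval. -/
lemma exists_measure_abs_le_diff_zero_pos {ν : Measure ℝ} (hν0 : ν {0} = 0) (hν : ν ≠ 0) :
    ∃ n : ℕ, 0 < ν ({y | |y| ≤ n} \ {0}) := by
  by_contra! h
  refine hν (Measure.measure_univ_eq_zero.1 (measure_mono_null ?_
    (measure_union_null hν0 (measure_iUnion_null fun n : ℕ => nonpos_iff_eq_zero.1 (h n)))))
  intro y _
  by_cases hy : y = 0
  · exact Or.inl hy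
  · exact Or.inr (Set.mem_iUnion.2 ((exists_nat_ge |y|).imp fun n hn => ⟨hn, hy⟩))

/-- For a nonzero Lévy measure, `∫ (1 - cos (ξ y)) ν(dy)` dominates a multiple of `ξ ^ 2`
near the origin. -/
lemma exists_mul_sq_le_integral_one_sub_cos {ν : Measure ℝ} (hν0 : ν {0} = 0)
    (hν : Integrable (fun y : ℝ => min (y ^ 2) 1) ν) (hne : ν ≠ 0) :
    ∃ C > (0 : ℝ), ∃ ε > (0 : ℝ), ∀ ξ : ℝ, |ξ| ≤ ε →
      C * ξ ^ 2 ≤ ∫ y, (1 - Real.cos (ξ * y)) ∂ν := by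
  obtain ⟨n, hn⟩ := exists_measure_abs_le_diff_zero_pos hν0 hne
  set s : Set ℝ := {y | |y| ≤ n}
  have hsm : MeasurableSet s := measurableSet_le (by fun_prop) (by fun_prop)
  set h : ℝ → ℝ := s.indicator fun y => min (y ^ 2) 1 with hh
  have hint : Integrable h ν := hν.indicator hsm
  have hnonneg : 0 ≤ h := fun y => Set.indicator_nonneg (fun y _ => by positivity) y
  have hpos : 0 < ∫ y, h y ∂ν := by
    rw [integral_pos_iff_support_of_nonneg hnonneg hint]
    refine hn.trans_le (measure_mono fun y hy => ?_)
    have hy0 : y ≠ 0 := hy.2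
    rw [Function.mem_support, hh, Set.indicator_of_mem hy.1]
    positivity
  refine ⟨2 / Real.pi ^ 2 * ∫ y, h y ∂ν, by positivity, 1 / (n + 1), by positivity, fun ξ hξ => ?_⟩
  calc 2 / Real.pi ^ 2 * (∫ y, h y ∂ν) * ξ ^ 2
      = ∫ y, 2 / Real.pi ^ 2 * ξ ^ 2 * h y ∂ν := by rw [integral_const_mul]; ring
    _ ≤ ∫ y, (1 - Real.cos (ξ * y)) ∂ν :=
        integral_mono (hint.const_mul _) (integrable_one_sub_cos hν ξ) fun y => ?_
  by_cases hy : y ∈ s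
  · have hbound : |ξ * y| ≤ Real.pi := by
      have hy' : |y| ≤ n := hy
      have hξ' : |ξ| * (n + 1) ≤ 1 := (le_div_iff₀ (by positivity)).1 hξ
      rw [abs_mul]
      nlinarith [abs_nonneg ξ, Real.pi_gt_three]
    have hcos := Real.cos_le_one_sub_mul_cos_sq hbound
    have hle : 2 / Real.pi ^ 2 * ξ ^ 2 * min (y ^ 2) 1 ≤ 2 / Real.pi ^ 2 * ξ ^ 2 * y ^ 2 := by
      gcongr
      exact min_le_left _ _
    simp only [hh, Set.indicator_of_mem hy]
    rw [mul_pow, ← mul_assoc] at hcos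
    linarith
  · simp only [hh, Set.indicator_of_notMem hy, mul_zero]
    linarith [Real.cos_le_one (ξ * y)]

theorem stmt13 (α γ : ℝ) (ν : Measure ℝ)
    (hν0 : ν {0} = 0) (hν : Integrable (fun y : ℝ => min (y ^ 2) 1) ν)
    (hnontriv : α ≠ 0 ∨ ν ≠ 0)
    (η : ℝ → ℂ) (hη : ∀ u : ℝ, η u = levyExp α γ ν u) :
    ∃ C > (0 : ℝ), ∃ ε > (0 : ℝ), ∀ ξ : ℝ, |ξ| ≤ ε → C * ξ ^ 2 ≤ -(η ξ).re := by
  simp only [hη, neg_re_levyExp hν]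
  rcases hnontriv with hα | hne
  · refine ⟨α ^ 2 / 2, by positivity, 1, one_pos, fun ξ _ => le_add_of_nonneg_right ?_⟩
    exact integral_nonneg fun y => sub_nonneg.2 (Real.cos_le_one _)
  · obtain ⟨C, hC, ε, hε, h⟩ := exists_mul_sq_le_integral_one_sub_cos hν0 hν hne
    exact ⟨C, hC, ε, hε, fun ξ hξ => (h ξ hξ).trans (le_add_of_nonneg_left (by positivity))⟩
end

section
/- For every ε > 0 there exist a sequence (φ_n)_{n∈ℕ} of functions in L¹(ℝ; ℝ) and a real number I ∈ (0, ∞) with the following properties: for every n ∈ ℕ, φ_n ≥ 0 and φ_n(x) = 0 for all x with |x| ≥ ε; the Fourier transform φ̂_n is real-valued, nonnegative and belongs to L¹(ℝ); and for every x ∈ ℝ, φ̂_n(x) → I as n → ∞. -/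
open MeasureTheory Complex Filter

/-- The Fourier transform of a (real-valued) integrable function on `ℝ`. -/
noncomputable def ftR (g : ℝ → ℝ) (ξ : ℝ) : ℂ :=
  ∫ x : ℝ, Complex.exp (Complex.I * ξ * x) * (g x : ℂ)

/-- The tent function of unit mass supported in `[-δ, δ]`. -/
noncomputable def tent (δ x : ℝ) : ℝ := max 0 ((1 - |x| / δ) / δ)

lemma tent_continuous (δ : ℝ) : Continuous (tent δ) := by
  unfold tent
  fun_prop

lemma tent_nonneg (δ x : ℝ) : 0 ≤ tent δ x := le_max_left _ _

lemma tent_neg (δ x : ℝ) : tent δ (-x) = tent δ x := by simp [tent]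

lemma tent_eq_zero {δ x : ℝ} (hδ : 0 < δ) (hx : δ ≤ |x|) : tent δ x = 0 := by
  refine max_eq_left (div_nonpos_of_nonpos_of_nonneg ?_ hδ.le)
  rw [sub_nonpos, le_div_iff₀ hδ]
  linarith

lemma tent_of_mem {δ x : ℝ} (hδ : 0 < δ) (h0 : 0 ≤ x) (hx : x ≤ δ) :
    tent δ x = (1 - x / δ) / δ := by
  rw [tent, abs_of_nonneg h0]
  refine max_eq_right (div_nonneg ?_ hδ.le)
  rw [sub_nonneg, div_le_iff₀ hδ]
  linarith

lemma tent_integrable {δ : ℝ} (hδ : 0 < δ) : Integrable (tent δ) := by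
  refine (tent_continuous δ).integrable_of_hasCompactSupport
    (HasCompactSupport.intro (isCompact_Icc (a := -δ) (b := δ)) fun x hx => tent_eq_zero hδ ?_)
  by_contra! h
  exact hx ⟨(abs_lt.1 h).1.le, (abs_lt.1 h).2.le⟩

lemma integral_exp_mul_tent {δ : ℝ} (hδ : 0 < δ) {c : ℂ} (hc : c ≠ 0) :
    ∫ x in (0 : ℝ)..δ, cexp (c * x) * (tent δ x : ℂ) =
      (cexp (c * δ) - 1) / (δ ^ 2 * c ^ 2) - 1 / (c * δ) := by
  have hδ' : (δ : ℂ) ≠ 0 := by exact_mod_cast hδ.ne'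
  have hderiv : ∀ x : ℝ, HasDerivAt
      (fun y : ℝ => cexp (c * y) * ((1 - y / δ) / c + 1 / (δ * c ^ 2)) / δ)
      (cexp (c * x) * ((1 - x / δ) / δ)) x := by
    intro x
    have hx : HasDerivAt (fun y : ℝ => (y : ℂ)) 1 x := Complex.ofRealCLM.hasDerivAt
    have h := (((hx.const_mul c).cexp.mul
      ((((hx.div_const (δ : ℂ)).const_sub 1).div_const c).add_const (1 / (δ * c ^ 2))))).div_const
        (δ : ℂ)
    refine h.congr_deriv ?_
    field_simp
    ring
  have hcongr : ∫ x in (0 : ℝ)..δ, cexp (c * x) * (tent δ x : ℂ) =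
      ∫ x in (0 : ℝ)..δ, cexp (c * x) * ((1 - x / δ) / δ) := by
    refine intervalIntegral.integral_congr fun x hx => ?_
    rw [Set.uIcc_of_le hδ.le] at hx
    simp [tent_of_mem hδ hx.1 hx.2]
  rw [hcongr, intervalIntegral.integral_eq_sub_of_hasDerivAt (fun x _ => hderiv x)
    (Continuous.intervalIntegrable (by fun_prop) _ _)]
  simp only [ofReal_zero, mul_zero, Complex.exp_zero]
  field_simp
  ring

lemma integral_tent_half {δ : ℝ} (hδ : 0 < δ) : ∫ x in (0 : ℝ)..δ, (tent δ x : ℂ) = 1 / 2 := by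
  have hcongr : ∫ x in (0 : ℝ)..δ, tent δ x = ∫ x in (0 : ℝ)..δ, (1 - x / δ) / δ := by
    refine intervalIntegral.integral_congr fun x hx => ?_
    rw [Set.uIcc_of_le hδ.le] at hx
    exact tent_of_mem hδ hx.1 hx.2
  have hval : ∫ x in (0 : ℝ)..δ, tent δ x = 1 / 2 := by
    rw [hcongr, intervalIntegral.integral_div, intervalIntegral.integral_sub
      (by simp) (Continuous.intervalIntegrable (by fun_prop) _ _), intervalIntegral.integral_div]
    simp only [intervalIntegral.integral_const, integral_id, smul_eq_mul]
    field_simp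
    ring
  rw [intervalIntegral.integral_ofReal, hval]
  norm_num

lemma ftR_tent_eq_add {δ : ℝ} (hδ : 0 < δ) (ξ : ℝ) :
    ftR (tent δ) ξ = (∫ x in (0 : ℝ)..δ, cexp (-(I * ξ) * x) * (tent δ x : ℂ)) +
      ∫ x in (0 : ℝ)..δ, cexp (I * ξ * x) * (tent δ x : ℂ) := by
  have hcont : Continuous fun x : ℝ => cexp (I * ξ * x) * (tent δ x : ℂ) := by
    have := tent_continuous δ
    fun_prop
  have hsupp : (Function.support fun x : ℝ => cexp (I * ξ * x) * (tent δ x : ℂ)) ⊆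
      Set.Ioc (-δ) δ := by
    intro x hx
    have h : |x| < δ := by
      by_contra! h
      exact hx (by simp [tent_eq_zero hδ h])
    exact ⟨(abs_lt.1 h).1, (abs_lt.1 h).2.le⟩
  have hneg : ∫ x in (0 : ℝ)..δ, cexp (-(I * ξ) * x) * (tent δ x : ℂ) =
      ∫ x in (-δ)..0, cexp (I * ξ * x) * (tent δ x : ℂ) := by
    have h := intervalIntegral.integral_comp_neg (a := 0) (b := δ)
      (fun x : ℝ => cexp (I * ξ * x) * (tent δ x : ℂ))
    simpa [tent_neg] using h
  rw [ftR, ← intervalIntegral.integral_eq_integral_of_support_subset hsupp, hneg,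
    intervalIntegral.integral_add_adjacent_intervals (hcont.intervalIntegrable _ _)
      (hcont.intervalIntegrable _ _)]

lemma ftR_tent {δ : ℝ} (hδ : 0 < δ) (ξ : ℝ) :
    ftR (tent δ) ξ = ((Real.sinc (δ / 2 * ξ) ^ 2 : ℝ) : ℂ) := by
  rw [ftR_tent_eq_add hδ]
  rcases eq_or_ne ξ 0 with rfl | hξ
  · simp [integral_tent_half hδ]
    norm_num
  have hδ' : (δ : ℂ) ≠ 0 := by exact_mod_cast hδ.ne'
  have hξ' : (ξ : ℂ) ≠ 0 := by exact_mod_cast hξ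
  have hc : I * (ξ : ℂ) ≠ 0 := mul_ne_zero I_ne_zero hξ'
  have hcos : cexp (-(I * ξ) * δ) + cexp (I * ξ * δ) = 2 - 4 * Complex.sin (δ / 2 * ξ) ^ 2 := by
    have h1 : Complex.cos (2 * (δ / 2 * ξ)) = 1 - 2 * Complex.sin (δ / 2 * ξ) ^ 2 := by
      rw [Complex.cos_two_mul, Complex.cos_sq']
      ring
    have h2 := Complex.two_cos (2 * (δ / 2 * ξ) : ℂ)
    rw [h1] at h2
    rw [show -(I * (ξ : ℂ)) * δ = -(2 * (δ / 2 * ξ)) * I by ring,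
      show I * (ξ : ℂ) * δ = 2 * (δ / 2 * ξ) * I by ring]
    linear_combination -h2
  rw [integral_exp_mul_tent hδ (neg_ne_zero.2 hc), integral_exp_mul_tent hδ hc,
    Real.sinc_of_ne_zero (mul_ne_zero (by positivity) hξ)]
  push_cast
  have hsum : (cexp (-(I * ξ) * δ) - 1) / ((δ : ℂ) ^ 2 * (-(I * ξ)) ^ 2) - 1 / (-(I * ξ) * δ) +
      ((cexp (I * ξ * δ) - 1) / ((δ : ℂ) ^ 2 * (I * ξ) ^ 2) - 1 / (I * ξ * δ)) =
      (cexp (-(I * ξ) * δ) + cexp (I * ξ * δ) - 2) / ((δ : ℂ) ^ 2 * (I * ξ) ^ 2) := by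
    rw [neg_sq, neg_mul (I * (ξ : ℂ)) (δ : ℂ), div_neg]
    ring
  rw [hsum, hcos, mul_pow I, I_sq]
  field_simp
  ring

lemma sinc_sq_integrable : Integrable fun x : ℝ => Real.sinc x ^ 2 := by
  refine (integrable_inv_one_add_sq.const_mul 2).mono'
    (Real.continuous_sinc.pow 2).aestronglyMeasurable (Eventually.of_forall fun x => ?_)
  rw [Real.norm_of_nonneg (sq_nonneg _), ← div_eq_mul_inv, le_div_iff₀ (by positivity)]
  have h1 : Real.sinc x ^ 2 ≤ 1 := by
    rw [sq_le_one_iff_abs_le_one]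
    exact abs_le.2 ⟨Real.neg_one_le_sinc x, Real.sinc_le_one x⟩
  have h2 : Real.sinc x ^ 2 * x ^ 2 ≤ 1 := by
    rcases eq_or_ne x 0 with rfl | hx
    · simp
    rw [Real.sinc_of_ne_zero hx, div_pow, div_mul_cancel₀ _ (pow_ne_zero 2 hx)]
    exact Real.sin_sq_le_one x
  linarith

theorem stmt17 (ε : ℝ) (hε : 0 < ε) :
    ∃ (φ : ℕ → ℝ → ℝ) (I : ℝ), 0 < I ∧
      (∀ n : ℕ,
        Integrable (φ n) ∧
        (∀ x : ℝ, 0 ≤ φ n x) ∧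
        (∀ x : ℝ, ε ≤ |x| → φ n x = 0) ∧
        (∀ ξ : ℝ, (ftR (φ n) ξ).im = 0 ∧ 0 ≤ (ftR (φ n) ξ).re) ∧
        Integrable (fun ξ : ℝ => ftR (φ n) ξ)) ∧
      ∀ x : ℝ, Tendsto (fun n : ℕ => ftR (φ n) x) atTop (nhds ((I : ℂ))) := by
  have hδ : ∀ n : ℕ, 0 < ε / ((n : ℝ) + 1) := fun n => by positivity
  refine ⟨fun n => tent (ε / ((n : ℝ) + 1)), 1, one_pos, fun n => ⟨tent_integrable (hδ n),
    tent_nonneg _, fun x hx => tent_eq_zero (hδ n) (le_trans ?_ hx), fun ξ => ?_, ?_⟩, fun x => ?_⟩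
  · exact div_le_self hε.le (by linarith [n.cast_nonneg (α := ℝ)])
  · rw [ftR_tent (hδ n), ofReal_im, ofReal_re]
    exact ⟨rfl, sq_nonneg _⟩
  · simp_rw [ftR_tent (hδ n)]
    exact (sinc_sq_integrable.comp_mul_left' (half_pos (hδ n)).ne').ofReal
  · simp_rw [fun n => ftR_tent (hδ n) x]
    have hlim : Tendsto (fun n : ℕ => ε / ((n : ℝ) + 1)) atTop (nhds 0) := by
      simpa [div_eq_mul_inv] using tendsto_one_div_add_atTop_nhds_zero_nat.const_mul ε
    have hcont : Continuous fun δ : ℝ => Real.sinc (δ / 2 * x) ^ 2 :=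
      (Real.continuous_sinc.comp (by fun_prop)).pow 2
    refine (continuous_ofReal.tendsto 1).comp ?_
    simpa [Function.comp_def] using (hcont.tendsto 0).comp hlim
end
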